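/- arXiv:2605.13090 — 2 statements merged into one kernel-verified Lean document; each statement's English description precedes it below -/
import Mathlib

section
/- Fix n ≥ 3, k ≥ 1, and nonzero complex numbers y_0,…,y_{k−1}. Define n×n matrices S_i = I_n (identity) and R_i^α equal to the identity except in rows/columns i, i+1 where it is the 2×2 block [[0, 1/y_α],[y_α, 0]]. Then these matrices satisfy all defining relations of M_kVT_n, hence define a representation ζ_2 : M_kVT_n → GL_n(ℂ) with ζ_2(s_i) = S_i and ζ_2(ρ_i^α) = R_i^α. -/
/-- Generators of the multi-virtual twin group `M_{k+1}VT_{m+2}`: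
`s i` for `i = 0, …, m` and `ρ i α` for `i = 0, …, m`, `α = 0, …, k`. -/
inductive MVTGen (m k : ℕ) : Type
  | s : Fin (m + 1) → MVTGen m k
  | rho : Fin (m + 1) → Fin (k + 1) → MVTGen m k

open FreeGroup in
/-- The defining relators of the multi-virtual twin group `M_{k+1}VT_{m+2}`. -/
def mvtRels (m k : ℕ) : Set (FreeGroup (MVTGen m k)) :=
  { r | (∃ i : Fin (m + 1), r = of (MVTGen.s i) * of (MVTGen.s i))
    ∨ (∃ i j : Fin (m + 1), (i.1 + 2 ≤ j.1 ∨ j.1 + 2 ≤ i.1) ∧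
        r = of (MVTGen.s i) * of (MVTGen.s j) * (of (MVTGen.s i))⁻¹ * (of (MVTGen.s j))⁻¹)
    ∨ (∃ (i : Fin (m + 1)) (α : Fin (k + 1)),
        r = of (MVTGen.rho i α) * of (MVTGen.rho i α))
    ∨ (∃ (i j : Fin (m + 1)) (α β : Fin (k + 1)), (i.1 + 2 ≤ j.1 ∨ j.1 + 2 ≤ i.1) ∧
        r = of (MVTGen.rho i α) * of (MVTGen.rho j β) *
            (of (MVTGen.rho i α))⁻¹ * (of (MVTGen.rho j β))⁻¹)
    ∨ (∃ (i j : Fin (m + 1)) (α : Fin (k + 1)), (i.1 + 2 ≤ j.1 ∨ j.1 + 2 ≤ i.1) ∧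
        r = of (MVTGen.rho i α) * of (MVTGen.s j) *
            (of (MVTGen.rho i α))⁻¹ * (of (MVTGen.s j))⁻¹)
    ∨ (∃ (i j : Fin (m + 1)) (α : Fin (k + 1)), j.1 = i.1 + 1 ∧
        r = of (MVTGen.rho i α) * of (MVTGen.rho j α) * of (MVTGen.rho i α) *
            (of (MVTGen.rho j α) * of (MVTGen.rho i α) * of (MVTGen.rho j α))⁻¹)
    ∨ (∃ (i j : Fin (m + 1)) (α β : Fin (k + 1)), j.1 = i.1 + 1 ∧ α.1 < β.1 ∧
        r = of (MVTGen.rho i α) * of (MVTGen.rho j β) * of (MVTGen.rho i β) *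
            (of (MVTGen.rho j β) * of (MVTGen.rho i β) * of (MVTGen.rho j α))⁻¹)
    ∨ (∃ (i j : Fin (m + 1)) (α β : Fin (k + 1)), j.1 = i.1 + 1 ∧ α.1 < β.1 ∧
        r = of (MVTGen.rho i α) * of (MVTGen.rho j α) * of (MVTGen.rho i β) *
            (of (MVTGen.rho j β) * of (MVTGen.rho i α) * of (MVTGen.rho j α))⁻¹)
    ∨ (∃ (i j : Fin (m + 1)) (α : Fin (k + 1)), j.1 = i.1 + 1 ∧
        r = of (MVTGen.rho i α) * of (MVTGen.rho j α) * of (MVTGen.s i) *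
            (of (MVTGen.s j) * of (MVTGen.rho i α) * of (MVTGen.rho j α))⁻¹) }

/-- The multi-virtual twin group `M_{k+1}VT_{m+2}`. -/
def MVT (m k : ℕ) : Type := PresentedGroup (mvtRels m k)

instance (m k : ℕ) : Group (MVT m k) := by unfold MVT; infer_instance

/-- The image in `M_{k+1}VT_{m+2}` of a generator. -/
def MVT.gen {m k : ℕ} (g : MVTGen m k) : MVT m k := PresentedGroup.of g

/-- The `n × n` matrix equal to the identity except for the `2 × 2` block
`[[a, b], [c, d]]` in rows and columns `i, i+1`. -/
def locMat (n : ℕ) (i : ℕ) (a b c d : ℂ) : Matrix (Fin n) (Fin n) ℂ :=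
  Matrix.of fun p q =>
    if p.1 = i ∧ q.1 = i then a
    else if p.1 = i ∧ q.1 = i + 1 then b
    else if p.1 = i + 1 ∧ q.1 = i then c
    else if p.1 = i + 1 ∧ q.1 = i + 1 then d
    else if p = q then 1 else 0

/-- Left multiplication by the local matrix acts on rows. -/
theorem zaux_mul (m : ℕ) (i : Fin (m + 2)) (y : ℂ)
    (M : Matrix (Fin (m + 3)) (Fin (m + 3)) ℂ) (p q : Fin (m + 3)) :
    (locMat (m + 3) i.1 0 y⁻¹ y 0 * M) p q =
      if p = i.castSucc then y⁻¹ * M i.succ q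
      else if p = i.succ then y * M i.castSucc q else M p q := by
  have hi := i.2
  rw [Matrix.mul_apply]
  split_ifs with h1 h2
  · rw [Finset.sum_eq_single i.succ]
    · subst h1
      simp [locMat]
    · intro b _ hb
      have : b.1 ≠ i.1 + 1 := fun h => hb (Fin.ext h)
      have h3 : i.castSucc = b → b.1 = i.1 := by rintro rfl; rfl
      subst h1
      simp only [locMat, Matrix.of_apply, Fin.val_castSucc, true_and]
      split_ifs <;> first | exact zero_mul _ | (exfalso; omega) |
        (exfalso; have := h3 (by assumption); omega)
    · simp
  · rw [Finset.sum_eq_single i.castSucc]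
    · subst h2
      simp [locMat]
    · intro b _ hb
      have : b.1 ≠ i.1 := fun h => hb (Fin.ext h)
      have h3 : i.succ = b → b.1 = i.1 + 1 := by rintro rfl; rfl
      subst h2
      simp only [locMat, Matrix.of_apply, Fin.val_succ, true_and]
      split_ifs <;> first | exact zero_mul _ | (exfalso; omega) |
        (exfalso; have := h3 (by assumption); omega)
    · simp
  · have e1 : p.1 ≠ i.1 := fun h => h1 (Fin.ext h)
    have e2 : p.1 ≠ i.1 + 1 := fun h => h2 (Fin.ext h)
    rw [Finset.sum_eq_single p]
    · simp [locMat, e1, e2]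
    · intro b _ hb
      simp [locMat, e1, e2, hb.symm]
    · simp

theorem zaux_sq (m : ℕ) (i : Fin (m + 2)) (y : ℂ) (hy : y ≠ 0) :
    locMat (m + 3) i.1 0 y⁻¹ y 0 * locMat (m + 3) i.1 0 y⁻¹ y 0 = 1 := by
  rw [← mul_one (locMat (m + 3) i.1 0 y⁻¹ y 0 * _), mul_assoc]
  ext p q
  have e : i.succ ≠ i.castSucc := by simp [Fin.ext_iff]
  simp only [zaux_mul]
  split_ifs with h1 h2
  · subst h1; simp [hy]
  · subst h2; simp [hy]
  · rfl

theorem zaux_comm (m : ℕ) (i j : Fin (m + 2)) (y z : ℂ)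
    (h : i.1 + 2 ≤ j.1 ∨ j.1 + 2 ≤ i.1) :
    locMat (m + 3) i.1 0 y⁻¹ y 0 * locMat (m + 3) j.1 0 z⁻¹ z 0 =
    locMat (m + 3) j.1 0 z⁻¹ z 0 * locMat (m + 3) i.1 0 y⁻¹ y 0 := by
  suffices key : ∀ N : Matrix (Fin (m + 3)) (Fin (m + 3)) ℂ,
      locMat (m + 3) i.1 0 y⁻¹ y 0 * (locMat (m + 3) j.1 0 z⁻¹ z 0 * N) =
      locMat (m + 3) j.1 0 z⁻¹ z 0 * (locMat (m + 3) i.1 0 y⁻¹ y 0 * N) by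
    simpa using key 1
  intro N
  ext p q
  simp only [zaux_mul, Fin.ext_iff, Fin.val_succ, Fin.val_castSucc]
  split_ifs <;> first | rfl | omega

theorem zaux_braid (m : ℕ) (i j : Fin (m + 2)) (a b c : ℂ) (h : j.1 = i.1 + 1) :
    locMat (m + 3) i.1 0 a⁻¹ a 0 * locMat (m + 3) j.1 0 b⁻¹ b 0 *
      locMat (m + 3) i.1 0 c⁻¹ c 0 =
    locMat (m + 3) j.1 0 c⁻¹ c 0 * locMat (m + 3) i.1 0 b⁻¹ b 0 *
      locMat (m + 3) j.1 0 a⁻¹ a 0 := by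
  suffices key : ∀ N : Matrix (Fin (m + 3)) (Fin (m + 3)) ℂ,
      locMat (m + 3) i.1 0 a⁻¹ a 0 * (locMat (m + 3) j.1 0 b⁻¹ b 0 *
        (locMat (m + 3) i.1 0 c⁻¹ c 0 * N)) =
      locMat (m + 3) j.1 0 c⁻¹ c 0 * (locMat (m + 3) i.1 0 b⁻¹ b 0 *
        (locMat (m + 3) j.1 0 a⁻¹ a 0 * N)) by
    simpa [mul_assoc] using key 1
  intro N
  have e : j.castSucc = i.succ := Fin.ext h
  ext p q
  simp only [zaux_mul, e]
  simp only [Fin.ext_iff, Fin.val_succ, Fin.val_castSucc, h]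
  split_ifs <;> first | rfl | omega | ring

/-- Images of the generators. -/
noncomputable def zauxGen (m k : ℕ) (y : Fin (k + 1) → ℂ) (hy : ∀ α, y α ≠ 0) :
    MVTGen (m + 1) k → GL (Fin (m + 3)) ℂ
  | MVTGen.s _ => 1
  | MVTGen.rho i α => ⟨locMat (m + 3) i.1 0 (y α)⁻¹ (y α) 0,
      locMat (m + 3) i.1 0 (y α)⁻¹ (y α) 0, zaux_sq m i _ (hy α), zaux_sq m i _ (hy α)⟩

theorem zaux_rels (m k : ℕ) (y : Fin (k + 1) → ℂ) (hy : ∀ α, y α ≠ 0) :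
    ∀ r ∈ mvtRels (m + 1) k, FreeGroup.lift (zauxGen m k y hy) r = 1 := by
  rintro r (⟨i, rfl⟩ | ⟨i, j, h, rfl⟩ | ⟨i, α, rfl⟩ | ⟨i, j, α, β, h, rfl⟩ | ⟨i, j, α, h, rfl⟩ |
    ⟨i, j, α, h, rfl⟩ | ⟨i, j, α, β, h, -, rfl⟩ | ⟨i, j, α, β, h, -, rfl⟩ | ⟨i, j, α, h, rfl⟩) <;>
    simp only [map_mul, map_inv, FreeGroup.lift_apply_of]
  · simp [zauxGen]
  · simp [zauxGen]
  · exact Units.ext (zaux_sq m i _ (hy α))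
  · rw [mul_inv_eq_one, mul_inv_eq_iff_eq_mul]
    exact Units.ext (zaux_comm m i j _ _ h)
  · change zauxGen m k y hy (MVTGen.rho i α) * 1 * (zauxGen m k y hy (MVTGen.rho i α))⁻¹ * 1⁻¹ = 1
    simp only [mul_one, inv_one, mul_inv_cancel]
  · rw [mul_inv_eq_one]
    exact Units.ext (zaux_braid m i j _ _ _ h)
  · rw [mul_inv_eq_one]
    exact Units.ext (zaux_braid m i j _ _ _ h)
  · rw [mul_inv_eq_one]
    exact Units.ext (zaux_braid m i j _ _ _ h)
  · rw [mul_inv_eq_one]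
    change _ * 1 = 1 * _ * _
    rw [mul_one, one_mul]

/-- The assignment `sᵢ ↦ Iₙ`, `ρᵢ^α ↦` (identity except the block `[[0, 1/y_α],[y_α, 0]]`
at rows/columns `i, i+1`) satisfies all defining relations of `M_{k+1}VT_{m+3}`, hence
defines a representation `ζ₂ : M_{k+1}VT_{m+3} → GL_{m+3}(ℂ)`. -/
theorem mvt_rep_zeta2 (m k : ℕ) (y : Fin (k + 1) → ℂ) (hy : ∀ α, y α ≠ 0) :
    ∃ ζ : MVT (m + 1) k →* GL (Fin (m + 3)) ℂ,
      (∀ i : Fin (m + 2),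
        ((ζ (MVT.gen (MVTGen.s i)) : GL (Fin (m + 3)) ℂ) :
          Matrix (Fin (m + 3)) (Fin (m + 3)) ℂ) = 1) ∧
      (∀ (i : Fin (m + 2)) (α : Fin (k + 1)),
        ((ζ (MVT.gen (MVTGen.rho i α)) : GL (Fin (m + 3)) ℂ) :
          Matrix (Fin (m + 3)) (Fin (m + 3)) ℂ) = locMat (m + 3) i.1 0 (y α)⁻¹ (y α) 0) := by
  refine ⟨PresentedGroup.toGroup (zaux_rels m k y hy), fun i => ?_, fun i α => ?_⟩
  · have : PresentedGroup.toGroup (zaux_rels m k y hy) (PresentedGroup.of (MVTGen.s i)) = _ :=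
      PresentedGroup.toGroup.of _
    exact congrArg Units.val this
  · have : PresentedGroup.toGroup (zaux_rels m k y hy) (PresentedGroup.of (MVTGen.rho i α)) = _ :=
      PresentedGroup.toGroup.of _
    exact congrArg Units.val this
end

section
/- Let n ≥ 3, k ≥ 2, and suppose there exist indices β_1 ≠ β_2 with y_{β_1} ≠ y_{β_2} (all y_α ∈ ℂ*). Let ζ_2 : M_kVT_n → GL_n(ℂ) be the representation with ζ_2(s_i) = I_n and ζ_2(ρ_i^α) equal to the identity except for the block [[0, 1/y_α],[y_α, 0]] at rows/columns i, i+1. Then ζ_2 is irreducible: the only subspaces of ℂ^n invariant under all the matrices ζ_2(ρ_i^α) are 0 and ℂ^n. -/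
theorem aux_mulVec (n i : ℕ) (h : i + 1 < n) (z : ℂ) (u : Fin n → ℂ) (p : Fin n) :
    (locMat n i 0 z⁻¹ z 0).mulVec u p =
      if p.1 = i then z⁻¹ * u ⟨i + 1, h⟩ else
      if p.1 = i + 1 then z * u ⟨i, by omega⟩ else u p := by
  simp only [Matrix.mulVec, dotProduct, locMat, Matrix.of_apply]
  split_ifs with h1 h2
  · rw [Finset.sum_eq_single ⟨i + 1, h⟩]
    · simp [h1]
    · intro b _ hb
      have h3 : b.1 ≠ i + 1 := fun hh => hb (Fin.ext hh)
      by_cases h4 : b.1 = i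
      · simp [h1, h4]
      · have h5 : p ≠ b := fun hh => h4 (by rw [← hh, h1])
        simp [h1, h3, h4, h5]
    · simp
  · rw [Finset.sum_eq_single ⟨i, by omega⟩]
    · simp [h2]
    · intro b _ hb
      have h3 : b.1 ≠ i := fun hh => hb (Fin.ext hh)
      by_cases h4 : b.1 = i + 1
      · simp [h2, h4]
      · have h5 : p ≠ b := fun hh => h4 (by rw [← hh, h2])
        simp [h2, h3, h4, h5]
    · simp
  · simp [h1, h2]

/-- If some `y_{β₁} ≠ y_{β₂}`, then the representation `ζ₂` (with `ζ₂(sᵢ) = Iₙ` and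
`ζ₂(ρᵢ^α)` the identity except the block `[[0, 1/y_α],[y_α, 0]]` at rows/columns
`i, i+1`) is irreducible: the only subspaces of `ℂⁿ` invariant under all the matrices
`ζ₂(ρᵢ^α)` are `0` and `ℂⁿ`. -/
theorem zeta2_distinct_params_irreducible (n : ℕ) (hn : 3 ≤ n) (k : ℕ) (hk : 2 ≤ k)
    (y : Fin k → ℂ) (hy : ∀ α, y α ≠ 0)
    (hdist : ∃ β₁ β₂ : Fin k, β₁ ≠ β₂ ∧ y β₁ ≠ y β₂)
    (U : Submodule ℂ (Fin n → ℂ))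
    (hU : ∀ (i : ℕ), i + 1 < n → ∀ α : Fin k,
      ∀ u ∈ U, (locMat n i 0 (y α)⁻¹ (y α) 0).mulVec u ∈ U) :
    U = ⊥ ∨ U = ⊤ := by
  obtain ⟨β₁, β₂, -, hne⟩ := hdist
  have ha := hy β₁
  have hb := hy β₂
  set a := y β₁ with hadef
  set b := y β₂ with hbdef
  have hab : a - b ≠ 0 := sub_ne_zero.mpr hne
  -- the basic operator
  have key : ∀ (i : ℕ) (h : i + 1 < n) (u : Fin n → ℂ), u ∈ U →
      (fun p : Fin n => if p.1 = i then u ⟨i + 1, h⟩ else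
        if p.1 = i + 1 then -(a * b) * u ⟨i, by omega⟩ else 0) ∈ U := by
    intro i h u hu
    have h1 := U.smul_mem (-(a * b) / (a - b)) (U.sub_mem (hU i h β₁ u hu) (hU i h β₂ u hu))
    convert h1 using 1
    funext p
    simp only [Pi.smul_apply, Pi.sub_apply, aux_mulVec n i h, smul_eq_mul, ← hadef, ← hbdef]
    split_ifs
    · field_simp
      ring
    · field_simp
    · simp
  have up : ∀ (i : ℕ) (h : i + 2 < n) (u : Fin n → ℂ), u ∈ U → u ⟨i, by omega⟩ ≠ 0 →
      (fun p : Fin n => if p.1 = i + 2 then (1 : ℂ) else 0) ∈ U := by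
    intro i h u hu h0
    have h1 := U.smul_mem ((a * b) ^ 2 * u ⟨i, by omega⟩)⁻¹
      (key (i + 1) h _ (key i (by omega) u hu))
    convert h1 using 1
    funext p
    simp only [Pi.smul_apply, smul_eq_mul]
    by_cases hp : p.1 = i + 2
    · simp [hp]
      field_simp
    · simp [hp]
      intros
      omega
  have down : ∀ (i : ℕ) (h : i + 2 < n) (u : Fin n → ℂ), u ∈ U → u ⟨i + 2, h⟩ ≠ 0 →
      (fun p : Fin n => if p.1 = i then (1 : ℂ) else 0) ∈ U := by
    intro i h u hu h0
    have h1 := U.smul_mem (u ⟨i + 2, h⟩)⁻¹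
      (key i (by omega) _ (key (i + 1) h u hu))
    convert h1 using 1
    funext p
    simp only [Pi.smul_apply, smul_eq_mul]
    by_cases hp : p.1 = i
    · simp [hp, h0]
    · simp [hp]
      intros
      omega
  rw [or_iff_not_imp_left]
  intro hbot
  obtain ⟨u, hu, hu0⟩ := U.ne_bot_iff.mp hbot
  obtain ⟨j, hj⟩ := Function.ne_iff.mp hu0
  have ex : ∃ m, m < n ∧ (fun p : Fin n => if p.1 = m then (1 : ℂ) else 0) ∈ U := by
    obtain ⟨j, hjn⟩ := j
    by_cases h1 : j + 2 < n
    · exact ⟨j + 2, h1, up j h1 u hu hj⟩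
    by_cases h2 : 2 ≤ j
    · obtain ⟨i, rfl⟩ := Nat.exists_eq_add_of_le' h2
      exact ⟨i, by omega, down i hjn u hu hj⟩
    obtain rfl : j = 1 := by omega
    exact ⟨2, by omega, up 0 (by omega) _ (key 0 (by omega) u hu) (by simpa using hj)⟩
  obtain ⟨m, hm, hmU⟩ := ex
  have stepUp : ∀ i, i + 1 < n → (fun p : Fin n => if p.1 = i then (1 : ℂ) else 0) ∈ U →
      (fun p : Fin n => if p.1 = i + 1 then (1 : ℂ) else 0) ∈ U := by
    intro i h hi
    convert U.smul_mem (-(a * b))⁻¹ (key i h _ hi) using 1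
    funext p
    simp only [Pi.smul_apply, smul_eq_mul]
    by_cases hp : p.1 = i + 1
    · simp [hp]
      field_simp
    · simp [hp]
  have stepDown : ∀ i, i + 1 < n → (fun p : Fin n => if p.1 = i + 1 then (1 : ℂ) else 0) ∈ U →
      (fun p : Fin n => if p.1 = i then (1 : ℂ) else 0) ∈ U := by
    intro i h hi
    convert key i h _ hi using 1
    funext p
    by_cases hp : p.1 = i <;> simp [hp]
  have zero : (fun p : Fin n => if p.1 = 0 then (1 : ℂ) else 0) ∈ U := by
    clear hj hu0 hu
    induction m with
    | zero => exact hmU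
    | succ m ih => exact ih (by omega) (stepDown m hm hmU)
  have all : ∀ i, i < n → (fun p : Fin n => if p.1 = i then (1 : ℂ) else 0) ∈ U := by
    intro i
    induction i with
    | zero => exact fun _ => zero
    | succ i ih => exact fun h => stepUp i h (ih (by omega))
  rw [eq_top_iff]
  intro v _
  have hv : v = ∑ i : Fin n, v i • (fun p : Fin n => if p.1 = i.1 then (1 : ℂ) else 0) := by
    funext p
    simp [Finset.sum_apply, ← Fin.ext_iff]
  rw [hv]
  exact U.sum_mem fun i _ => U.smul_mem _ (all i.1 i.2)
end
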